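/- The number of non-crossing partitions of [mk] in which there are exactly α_i parts of size m·i for each i ∈ [k] (where ∑ i·α_i = k and a = ∑ α_i) equals C(mk, a-1) · (a-1)!/(α_1!⋯α_k!). -/

import Mathlib

open Finset
open scoped Classical

def IsPartitionOf (n : ℕ) (P : Finset (Finset (Fin n))) : Prop :=
  (∀ p ∈ P, p.Nonempty) ∧
  (∀ p ∈ P, ∀ q ∈ P, p ≠ q → Disjoint p q) ∧
  P.sup id = Finset.univ

def IsNonCrossing (n : ℕ) (P : Finset (Finset (Fin n))) : Prop :=
  ¬ ∃ a b c d : Fin n, a < b ∧ b < c ∧ c < d ∧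
    ∃ p ∈ P, ∃ q ∈ P, p ≠ q ∧ a ∈ p ∧ c ∈ p ∧ b ∈ q ∧ d ∈ q

/-- The sets `B j`, for `j ∈ J`, are pairwise disjoint and pairwise non-crossing. -/
def NonCrossingFamily {ι β : Type*} [LinearOrder β] (J : Finset ι) (B : ι → Finset β) : Prop :=
  ∀ i ∈ J, ∀ j ∈ J, i ≠ j → Disjoint (B i) (B j) ∧
    ∀ a ∈ B i, ∀ b ∈ B j, ∀ c ∈ B i, ∀ d ∈ B j, ¬ (a < b ∧ b < c ∧ c < d)

theorem NonCrossingFamily.mono {ι β : Type*} [LinearOrder β] {J J' : Finset ι}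
    {B : ι → Finset β} (h : NonCrossingFamily J B) (hJ : J' ⊆ J) : NonCrossingFamily J' B :=
  fun i hi j hj => h i (hJ hi) j (hJ hj)

/-- A finite linear order has an initial segment of every admissible size. -/
theorem exists_initialSegment {β : Type*} [LinearOrder β] (V : Finset β) (s : ℕ)
    (hs : s ≤ #V) : ∃ I ⊆ V, #I = s ∧ ∀ y ∈ V, y ∉ I → ∀ z ∈ I, z < y := by
  induction s with
  | zero => exact ⟨∅, by simp⟩
  | succ s ih =>
    obtain ⟨I, hIV, hc, hI⟩ := ih (by omega)
    have hne : (V \ I).Nonempty := by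
      rw [← Finset.card_pos, Finset.card_sdiff_of_subset hIV]; omega
    have hmin := Finset.min'_mem _ hne
    set x := (V \ I).min' hne with hx
    rw [Finset.mem_sdiff] at hmin
    refine ⟨insert x I, Finset.insert_subset hmin.1 hIV, by simp [hmin.2, hc], ?_⟩
    intro y hy hyI z hz
    rw [Finset.mem_insert, not_or] at hyI
    rcases Finset.mem_insert.1 hz with rfl | hz
    · exact lt_of_le_of_ne (Finset.min'_le _ _ (by simp [hy, hyI.2])) (Ne.symm hyI.1)
    · exact hI y hy hyI.2 z hz

/-- Initial segments of a finite linear order are determined by their size. -/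
theorem initialSegment_unique {β : Type*} [LinearOrder β] {V I I' : Finset β}
    (hI : I ⊆ V) (hI' : I' ⊆ V) (hc : #I = #I')
    (h : ∀ y ∈ V, y ∉ I → ∀ z ∈ I, z < y) (h' : ∀ y ∈ V, y ∉ I' → ∀ z ∈ I', z < y) :
    I = I' := by
  by_contra hne
  have h1 : ¬ I ⊆ I' := fun hs => hne (Finset.eq_of_subset_of_card_le hs hc.ge)
  have h2 : ¬ I' ⊆ I := fun hs => hne (Finset.eq_of_subset_of_card_le hs hc.le).symm
  obtain ⟨y, hy, hy'⟩ := Finset.not_subset.1 h1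
  obtain ⟨z, hz, hz'⟩ := Finset.not_subset.1 h2
  exact lt_asymm (h z (hI' hz) hz' y hy) (h' y (hI hy) hy' z hz)

/-- Under the ballot condition there is a non-crossing family with prescribed sizes and minima. -/
theorem exists_nonCrossingFamily {ι β : Type*} [LinearOrder β] (p : ι → β) (s : ι → ℕ)
    (hs : ∀ j, 0 < s j) (J : Finset ι) : ∀ U : Finset β, Set.InjOn p J →
    (∀ j ∈ J, p j ∈ U) → ∑ j ∈ J, s j = #U →
    (∀ t, #{x ∈ U | x < t} ≤ ∑ j ∈ J with p j < t, s j) →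
    ∃ B : ι → Finset β, (∀ j ∈ J, #(B j) = s j ∧ IsLeast (B j : Set β) (p j) ∧ B j ⊆ U) ∧
      NonCrossingFamily J B := by
  induction J using Finset.induction_on_max_value p with
  | empty => intro U _ _ _ _; exact ⟨fun _ => ∅, by simp, by simp [NonCrossingFamily]⟩
  | insert a J haJ hmax ih =>
    intro U hinj hU hsum hb
    have hlt : ∀ i ∈ J, p i < p a := fun i hi => lt_of_le_of_ne (hmax i hi) fun h =>
      haJ (hinj (by simp [hi]) (by simp) h ▸ hi)
    rw [Finset.sum_insert haJ] at hsum
    have hfilt : ({j ∈ insert a J | p j < p a} : Finset ι) = J := by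
      ext i; simp only [Finset.mem_filter, Finset.mem_insert]
      constructor
      · rintro ⟨rfl | h, h'⟩
        · exact absurd h' (lt_irrefl _)
        · exact h
      · exact fun h => ⟨Or.inr h, hlt i h⟩
    have hcard : s a ≤ #{x ∈ U | ¬ x < p a} := by
      have h1 := hb (p a)
      rw [hfilt] at h1
      have h2 := Finset.card_filter_add_card_filter_not (s := U) (fun x => x < p a)
      omega
    obtain ⟨I, hIV, hIc, hI⟩ := exists_initialSegment _ _ hcard
    have hIU : I ⊆ U := hIV.trans (Finset.filter_subset _ _)
    have hIge : ∀ y ∈ I, p a ≤ y := fun y hy => not_lt.1 (Finset.mem_filter.1 (hIV hy)).2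
    have hpaI : p a ∈ I := by
      by_contra h
      obtain ⟨z, hz⟩ := Finset.card_pos.1 (hIc ▸ hs a)
      exact absurd (hI (p a) (by simp [hU a (by simp)]) h z hz) (not_lt.2 (hIge z hz))
    obtain ⟨B, hB, hNC⟩ := ih (U \ I) (hinj.mono (by simp)) (fun j hj => by
        rw [Finset.mem_sdiff]
        exact ⟨hU j (by simp [hj]), fun h => absurd (hIge _ h) (not_le.2 (hlt j hj))⟩)
      (by rw [Finset.card_sdiff_of_subset hIU]; omega) (fun t => by
        rcases le_or_gt t (p a) with ht | ht
        · refine (Finset.card_le_card (Finset.filter_subset_filter _ Finset.sdiff_subset)).trans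
            ((hb t).trans (le_of_eq ?_))
          rw [Finset.filter_insert, if_neg (not_lt.2 ht)]
        · rw [Finset.filter_true_of_mem (s := J) fun i hi => (hlt i hi).trans ht]
          refine (Finset.card_filter_le _ _).trans ?_
          rw [Finset.card_sdiff_of_subset hIU]; omega)
    have hBI : ∀ i ∈ J, ∀ y ∈ B i, y ∈ U ∧ y ∉ I := fun i hi y hy =>
      Finset.mem_sdiff.1 ((hB i hi).2.2 hy)
    have hout : ∀ i ∈ J, ∀ y ∈ B i, ∀ z ∈ I, z < y → ∀ w ∈ I, w < y := by
      intro i hi y hy z hz hzy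
      exact hI y (by simp [(hBI i hi y hy).1, (hIge z hz).trans hzy.le]) (hBI i hi y hy).2
    have hne : ∀ i ∈ J, i ≠ a := fun i hi h => haJ (h ▸ hi)
    refine ⟨Function.update B a I, ?_, ?_⟩
    · intro j hj
      rcases Finset.mem_insert.1 hj with rfl | hj
      · simpa [hIc, hIU] using ⟨hpaI, hIge⟩
      · rw [Function.update_of_ne (hne j hj)]
        exact ⟨(hB j hj).1, (hB j hj).2.1, (hB j hj).2.2.trans Finset.sdiff_subset⟩
    · intro i hi j hj hij
      rcases Finset.mem_insert.1 hi with hia | hi' <;>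
        rcases Finset.mem_insert.1 hj with hja | hj'
      · exact absurd (hia.trans hja.symm) hij
      · subst hia
        rw [Function.update_self, Function.update_of_ne (hne j hj')]
        refine ⟨Finset.disjoint_right.2 fun y hy => (hBI j hj' y hy).2, ?_⟩
        rintro x hx b hb c hc d hd ⟨h1, h2, h3⟩
        exact lt_asymm h2 (hout j hj' b hb x hx h1 c hc)
      · subst hja
        rw [Function.update_self, Function.update_of_ne (hne i hi')]
        refine ⟨Finset.disjoint_left.2 fun y hy => (hBI i hi' y hy).2, ?_⟩
        rintro x hx b hb c hc d hd ⟨h1, h2, h3⟩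
        exact lt_asymm h3 (hout i hi' c hc b hb h2 d hd)
      · rw [Function.update_of_ne (hne i hi'), Function.update_of_ne (hne j hj')]
        exact hNC i hi' j hj' hij

theorem NonCrossingFamily.biUnion_eq {ι β : Type*} [LinearOrder β] {J : Finset ι}
    {B : ι → Finset β} (h : NonCrossingFamily J B) {U : Finset β} (hU : ∀ j ∈ J, B j ⊆ U)
    (hc : ∑ j ∈ J, #(B j) = #U) : J.biUnion B = U := by
  refine Finset.eq_of_subset_of_card_le (Finset.biUnion_subset.2 hU) ?_
  rw [Finset.card_biUnion fun i hi j hj hij => (h i hi j hj hij).1, hc]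

/-- In a non-crossing family covering `U`, the block with the largest minimum is an interval. -/
theorem NonCrossingFamily.lt_of_notMem {ι β : Type*} [LinearOrder β] {J : Finset ι} {p : ι → β}
    {B : ι → Finset β} (h : NonCrossingFamily J B) {U : Finset β} (hU : ∀ j ∈ J, B j ⊆ U)
    (hc : ∑ j ∈ J, #(B j) = #U) (hp : ∀ j ∈ J, IsLeast (B j : Set β) (p j)) {a : ι} (ha : a ∈ J)
    (hmax : ∀ j ∈ J, p j ≤ p a) :
    ∀ y ∈ U.filter (fun y => p a ≤ y), y ∉ B a → ∀ z ∈ B a, z < y := by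
  intro y hy hya z hz
  obtain ⟨hyU, hay⟩ := Finset.mem_filter.1 hy
  rw [← h.biUnion_eq hU hc, Finset.mem_biUnion] at hyU
  obtain ⟨i, hi, hyi⟩ := hyU
  have hia : i ≠ a := fun e => hya (e ▸ hyi)
  obtain ⟨hd, hx⟩ := h i hi a ha hia
  have hpa : p a ∈ B a := (hp a ha).1
  have hpi : p i ∈ B i := (hp i hi).1
  by_contra hzy
  refine hx (p i) hpi (p a) hpa y hyi z hz ⟨lt_of_le_of_ne (hmax i hi) fun e => ?_,
    lt_of_le_of_ne hay fun e => hya (e ▸ hpa), lt_of_le_of_ne (not_lt.1 hzy) fun e => hya (e ▸ hz)⟩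
  exact Finset.disjoint_left.1 hd hpi (e ▸ hpa)

/-- A non-crossing family covering `U` is determined by the sizes and the minima of its blocks. -/
theorem NonCrossingFamily.unique {ι β : Type*} [LinearOrder β] (p : ι → β) (s : ι → ℕ)
    (B B' : ι → Finset β) (J : Finset ι) : ∀ U : Finset β, ∑ j ∈ J, s j = #U →
    (∀ j ∈ J, #(B j) = s j ∧ IsLeast (B j : Set β) (p j) ∧ B j ⊆ U) →
    (∀ j ∈ J, #(B' j) = s j ∧ IsLeast (B' j : Set β) (p j) ∧ B' j ⊆ U) →
    NonCrossingFamily J B → NonCrossingFamily J B' → ∀ j ∈ J, B j = B' j := by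
  induction J using Finset.induction_on_max_value p with
  | empty => simp
  | insert a J haJ hmax ih =>
    intro U hsum hB hB' hNC hNC'
    have ha : a ∈ insert a J := by simp
    have hmax' : ∀ j ∈ insert a J, p j ≤ p a := by simpa using hmax
    have hne : ∀ i ∈ J, i ≠ a := fun i hi h => haJ (h ▸ hi)
    have key := hNC.lt_of_notMem (fun j hj => (hB j hj).2.2)
      ((Finset.sum_congr rfl fun j hj => (hB j hj).1).trans hsum) (fun j hj => (hB j hj).2.1)
      ha hmax'
    have key' := hNC'.lt_of_notMem (fun j hj => (hB' j hj).2.2)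
      ((Finset.sum_congr rfl fun j hj => (hB' j hj).1).trans hsum) (fun j hj => (hB' j hj).2.1)
      ha hmax'
    have hsub : B a ⊆ U.filter (fun y => p a ≤ y) := fun y hy =>
      Finset.mem_filter.2 ⟨(hB a ha).2.2 hy, (hB a ha).2.1.2 hy⟩
    have hsub' : B' a ⊆ U.filter (fun y => p a ≤ y) := fun y hy =>
      Finset.mem_filter.2 ⟨(hB' a ha).2.2 hy, (hB' a ha).2.1.2 hy⟩
    have heq : B a = B' a := initialSegment_unique hsub hsub'
      ((hB a ha).1.trans (hB' a ha).1.symm) key key'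
    have hrest : ∀ j ∈ J, B j = B' j := by
      refine ih (U \ B a) ?_ (fun j hj => ?_) (fun j hj => ?_)
        (hNC.mono (Finset.subset_insert _ _)) (hNC'.mono (Finset.subset_insert _ _))
      · rw [Finset.card_sdiff_of_subset (hB a ha).2.2, (hB a ha).1, ← hsum,
          Finset.sum_insert haJ]; omega
      · have hj' := Finset.mem_insert_of_mem (a := j) (b := a) hj
        exact ⟨(hB j hj').1, (hB j hj').2.1, Finset.subset_sdiff.2
          ⟨(hB j hj').2.2, (hNC j hj' a ha (hne j hj)).1⟩⟩
      · have hj' := Finset.mem_insert_of_mem (a := j) (b := a) hj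
        exact ⟨(hB' j hj').1, (hB' j hj').2.1, Finset.subset_sdiff.2
          ⟨(hB' j hj').2.2, heq ▸ (hNC' j hj' a ha (hne j hj)).1⟩⟩
    intro j hj
    rcases Finset.mem_insert.1 hj with rfl | hj
    · exact heq
    · exact hrest j hj

/-- The cycle lemma: a sequence of period `n + 1` whose sum over a period is `n` has exactly one
starting point from which all partial sums are large enough. -/
theorem existsUnique_cyclic_shift (n : ℕ) (g : ℕ → ℕ) (hper : ∀ u, g (u + (n + 1)) = g u)
    (hsum : ∑ i ∈ range (n + 1), g i = n) :
    ∃! r, r < n + 1 ∧ ∀ t < n + 1, t ≤ ∑ i ∈ range t, g (r + i) := by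
  set S : ℕ → ℤ := fun t => ∑ i ∈ range t, (g i : ℤ) - t with hS
  have hgood : ∀ r t, t ≤ ∑ i ∈ range t, g (r + i) ↔ S r ≤ S (r + t) := by
    intro r t
    simp only [hS, Finset.sum_range_add, ← Nat.cast_sum]
    push_cast
    zify
    constructor <;> intro h <;> linarith
  have hSper : ∀ t, S (t + (n + 1)) = S t - 1 := by
    intro t
    simp only [hS]
    rw [add_comm t, Finset.sum_range_add]
    have h1 : ∑ i ∈ range (n + 1), (g i : ℤ) = n := by exact_mod_cast hsum
    have h2 : ∀ i, g (n + 1 + i) = g i := fun i => by rw [add_comm, hper]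
    simp only [h1, h2]
    push_cast
    ring
  simp only [hgood]
  have hex : ∃ r, r < n + 1 ∧ ∀ u < n + 1, S r ≤ S u := by
    obtain ⟨r, hr, h⟩ := Finset.exists_min_image (range (n + 1)) S ⟨0, by simp⟩
    exact ⟨r, by simpa using hr, fun u hu => h u (by simpa using hu)⟩
  obtain ⟨hr, hmin⟩ := Nat.find_spec hex
  have hfirst : ∀ u < Nat.find hex, S (Nat.find hex) < S u := by
    intro u hu
    have := Nat.find_min hex hu
    push Not at this
    obtain ⟨v, hv, hvu⟩ := this (hu.trans hr)
    exact (hmin v hv).trans_lt hvu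
  have hgood' : ∀ t < n + 1, S (Nat.find hex) ≤ S (Nat.find hex + t) := by
    intro t ht
    rcases lt_or_ge (Nat.find hex + t) (n + 1) with h | h
    · exact hmin _ h
    · obtain ⟨u, hu⟩ := Nat.exists_eq_add_of_le' h
      rw [hu, hSper]
      have := hfirst u (by omega)
      omega
  have huniq : ∀ r r', r' < n + 1 → (∀ t < n + 1, S r ≤ S (r + t)) →
      (∀ t < n + 1, S r' ≤ S (r' + t)) → ¬ r < r' := by
    intro r r' hr' h h' hlt
    have h1 := h (r' - r) (by omega)
    have h2 := h' (r + (n + 1) - r') (by omega)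
    rw [Nat.add_sub_cancel' hlt.le] at h1
    rw [Nat.add_sub_cancel' (by omega), hSper] at h2
    omega
  refine ⟨Nat.find hex, ⟨hr, hgood'⟩, ?_⟩
  rintro r ⟨hr1, hr2⟩
  rcases lt_trichotomy r (Nat.find hex) with h | h | h
  · exact absurd h (huniq _ _ hr hr2 hgood')
  · exact h
  · exact absurd h (huniq _ _ hr1 hgood' hr2)

/-- Every function on a finite type with values in `Fin (n + 1)` has exactly one rotation satisfying
the ballot condition. -/
theorem existsUnique_ballot_rotation {ι : Type*} [Fintype ι] (n : ℕ) (s : ι → ℕ)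
    (hsum : ∑ j, s j = n) (q : ι → Fin (n + 1)) :
    ∃! r : Fin (n + 1), ∀ t < n + 1, t ≤ ∑ j with ((q j - r : Fin (n + 1)) : ℕ) < t, s j := by
  have key : ∀ r t : ℕ, t ≤ n + 1 →
      ∑ i ∈ range t, ∑ j with q j = Fin.ofNat (n + 1) (r + i), s j =
        ∑ j with ((q j - Fin.ofNat (n + 1) r : Fin (n + 1)) : ℕ) < t, s j := by
    intro r t ht
    rw [← Finset.sum_fiberwise_of_maps_to (s := Finset.univ.filter
      fun j => ((q j - Fin.ofNat (n + 1) r : Fin (n + 1)) : ℕ) < t) (t := range t)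
      (g := fun j => ((q j - Fin.ofNat (n + 1) r : Fin (n + 1)) : ℕ)) (by simp)]
    refine Finset.sum_congr rfl fun i hi => Finset.sum_congr ?_ fun _ _ => rfl
    have hi := Finset.mem_range.1 hi
    ext j
    have hadd : Fin.ofNat (n + 1) (r + i) = Fin.ofNat (n + 1) i + Fin.ofNat (n + 1) r := by
      ext; simp [Fin.val_add, add_comm]
    simp only [Finset.mem_filter, Finset.mem_univ, true_and, hadd, ← sub_eq_iff_eq_add]
    constructor
    · intro h
      rw [h]
      simp [Nat.mod_eq_of_lt (hi.trans_le ht), hi]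
    · rintro ⟨-, h⟩
      exact Fin.ext (h.trans (Nat.mod_eq_of_lt (hi.trans_le ht)).symm)
  obtain ⟨r, ⟨hr, hgood⟩, huniq⟩ := existsUnique_cyclic_shift n
    (fun u => ∑ j with q j = Fin.ofNat (n + 1) u, s j)
    (fun u => by
      have : Fin.ofNat (n + 1) (u + (n + 1)) = Fin.ofNat (n + 1) u := by ext; simp
      simp only [this])
    (by
      have := key 0 (n + 1) le_rfl
      simp only [zero_add] at this
      rw [this, Finset.filter_true_of_mem fun j _ => Fin.is_lt _, hsum])
  refine ⟨Fin.ofNat (n + 1) r, fun t ht => key r t ht.le ▸ hgood t ht, fun r' hr' => ?_⟩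
  have hval : Fin.ofNat (n + 1) (r' : ℕ) = r' := by ext; simp
  rw [← huniq r' ⟨r'.is_lt, fun t ht => ?_⟩, hval]
  rw [key r' t ht.le, hval]
  exact hr' t ht

theorem card_filter_injective {ι β : Type*} [Fintype ι] [Fintype β]
    [DecidablePred (Function.Injective : (ι → β) → Prop)] :
    #{q : ι → β | Function.Injective q} = (Fintype.card β).descFactorial (Fintype.card ι) := by
  rw [← Fintype.card_embedding_eq, ← Fintype.card_subtype]
  exact Fintype.card_congr (Equiv.subtypeInjectiveEquivEmbedding ι β)

theorem card_ballot {ι : Type*} [Fintype ι] (n : ℕ) (s : ι → ℕ) (hsum : ∑ j, s j = n) :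
    (n + 1) * #{q : ι → Fin (n + 1) | Function.Injective q ∧
      ∀ t < n + 1, t ≤ ∑ j with (q j : ℕ) < t, s j} =
      (n + 1).descFactorial (Fintype.card ι) := by
  have hcount := Finset.sum_card_bipartiteAbove_eq_sum_card_bipartiteBelow
    (s := (Finset.univ : Finset (Fin (n + 1))))
    (t := Finset.univ.filter fun q : ι → Fin (n + 1) => Function.Injective q)
    (fun r q => ∀ t < n + 1, t ≤ ∑ j with ((q j - r : Fin (n + 1)) : ℕ) < t, s j)
  have hbelow : ∀ q : ι → Fin (n + 1), #(Finset.univ.bipartiteBelow (fun r q =>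
      ∀ t < n + 1, t ≤ ∑ j with ((q j - r : Fin (n + 1)) : ℕ) < t, s j) q) = 1 := by
    intro q
    obtain ⟨r, hr, huniq⟩ := existsUnique_ballot_rotation n s hsum q
    refine Finset.card_eq_one.2 ⟨r, ?_⟩
    ext r'
    simp only [Finset.bipartiteBelow, Finset.mem_filter, Finset.mem_univ, true_and,
      Finset.mem_singleton]
    exact ⟨huniq r', fun h => h ▸ hr⟩
  rw [Finset.sum_congr rfl fun q _ => hbelow q, Finset.sum_const, card_filter_injective,
    Fintype.card_fin, smul_eq_mul, mul_one] at hcount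
  rw [← hcount, Finset.sum_congr rfl fun r _ => ?_, Finset.sum_const, Finset.card_univ,
    Fintype.card_fin, smul_eq_mul]
  refine Finset.card_bij' (fun q _ j => q j - r) (fun q _ j => q j + r) ?_ ?_ ?_ ?_
  · intro q hq
    simp only [Finset.bipartiteAbove, Finset.mem_filter, Finset.mem_univ, true_and] at hq ⊢
    exact ⟨fun i j h => hq.1 (sub_left_injective h), hq.2⟩
  · intro q hq
    simp only [Finset.bipartiteAbove, Finset.mem_filter, Finset.mem_univ, true_and] at hq ⊢
    exact ⟨fun i j h => hq.1 (add_left_injective _ h), by simpa using hq.2⟩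
  · intro q _; simp
  · intro q _; simp

theorem NonCrossingFamily.ballot {ι : Type*} [Fintype ι] {n : ℕ} {s : ι → ℕ}
    (hsum : ∑ j, s j = n) {B : ι → Finset (Fin n)} (hB : NonCrossingFamily Finset.univ B)
    (hc : ∀ j, #(B j) = s j) {p : ι → Fin n} (hp : ∀ j, IsLeast (B j : Set (Fin n)) (p j))
    (t : ℕ) (ht : t < n + 1) : t ≤ ∑ j with (p j : ℕ) < t, s j := by
  have hU := hB.biUnion_eq (U := Finset.univ) (fun _ _ => Finset.subset_univ _) (by simp [hc, hsum])
  have h1 : #{x : Fin n | (x : ℕ) < t} = t := by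
    rw [Fin.card_filter_val_lt]; omega
  rw [← Finset.sum_congr rfl fun j _ => hc j]
  refine h1.symm.le.trans ((Finset.card_le_card fun x hx => ?_).trans Finset.card_biUnion_le)
  have hxU := Finset.mem_univ x
  rw [← hU, Finset.mem_biUnion] at hxU
  obtain ⟨j, -, hj⟩ := hxU
  refine Finset.mem_biUnion.2 ⟨j, ?_, hj⟩
  simp only [Finset.mem_filter, Finset.mem_univ, true_and] at hx ⊢
  exact lt_of_le_of_lt ((hp j).2 hj) hx

/-- The number of labelled non-crossing partitions of `Fin n` with prescribed block sizes. -/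
theorem card_nonCrossingFamily {ι : Type*} [Fintype ι] [Nonempty ι] (n : ℕ) (s : ι → ℕ)
    (hs : ∀ j, 0 < s j) (hsum : ∑ j, s j = n) :
    #{B : ι → Finset (Fin n) | (∀ j, #(B j) = s j) ∧ NonCrossingFamily Finset.univ B} =
      n.descFactorial (Fintype.card ι - 1) := by
  have hballot := card_ballot n s hsum
  obtain ⟨c, hc⟩ := Nat.exists_eq_succ_of_ne_zero (Fintype.card_ne_zero (α := ι))
  rw [hc, Nat.succ_eq_add_one, Nat.succ_descFactorial_succ] at hballot
  rw [hc, Nat.succ_sub_one, ← Nat.eq_of_mul_eq_mul_left n.succ_pos hballot]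
  have hne : ∀ B ∈ ({B : ι → Finset (Fin n) | (∀ j, #(B j) = s j) ∧
      NonCrossingFamily Finset.univ B} : Finset _), ∀ j, (B j).Nonempty := fun B hB j =>
    Finset.card_pos.1 (((Finset.mem_filter.1 hB).2.1 j).symm ▸ hs j)
  refine Finset.card_bij (fun B hB j => ((B j).min' (hne B hB j)).castSucc) ?_ ?_ ?_
  · intro B hB
    have hB' := (Finset.mem_filter.1 hB).2
    simp only [Finset.mem_filter, Finset.mem_univ, true_and, Fin.val_castSucc]
    refine ⟨fun i j hij => ?_,
      hB'.2.ballot hsum hB'.1 fun j => Finset.isLeast_min' _ (hne B hB j)⟩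
    by_contra h
    have hd := (hB'.2 i (Finset.mem_univ _) j (Finset.mem_univ _) h).1
    refine Finset.disjoint_left.1 hd (Finset.min'_mem _ (hne B hB i)) ?_
    rw [Fin.castSucc_injective _ hij]
    exact Finset.min'_mem _ _
  · intro B hB B' hB' h
    have h1 := (Finset.mem_filter.1 hB).2
    have h2 := (Finset.mem_filter.1 hB').2
    funext j
    refine NonCrossingFamily.unique (fun j => (B j).min' (hne B hB j)) s B B' Finset.univ
      Finset.univ (by simp [hsum])
      (fun j _ => ⟨h1.1 j, Finset.isLeast_min' _ _, Finset.subset_univ _⟩)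
      (fun j _ => ⟨h2.1 j, ?_, Finset.subset_univ _⟩) h1.2 h2.2 j (Finset.mem_univ _)
    rw [Fin.castSucc_injective _ (congrFun h j)]
    exact Finset.isLeast_min' _ _
  · intro q hq
    obtain ⟨hinj, hb⟩ := (Finset.mem_filter.1 hq).2
    have hlt : ∀ j, (q j : ℕ) < n := by
      intro j
      by_contra hj
      have h1 := hb n (by omega)
      have h2 : ∑ i with (q i : ℕ) < n, s i < ∑ i, s i :=
        Finset.sum_lt_sum_of_subset (Finset.filter_subset _ _) (Finset.mem_univ j)
          (by simp [not_lt.1 hj]) (hs j) (fun _ _ _ => Nat.zero_le _)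
      omega
    obtain ⟨B, hB, hNC⟩ := exists_nonCrossingFamily (fun j => (⟨q j, hlt j⟩ : Fin n)) s hs
      Finset.univ Finset.univ
      (fun i _ j _ h => hinj (Fin.ext (by simpa using h))) (by simp) (by simp [hsum])
      (fun t => by
        have h1 : #{x : Fin n | (x : ℕ) < t} = t := by
          rw [Fin.card_filter_val_lt]; omega
        exact h1.le.trans (hb t (by omega)))
    have hmem : B ∈ ({B : ι → Finset (Fin n) | (∀ j, #(B j) = s j) ∧
        NonCrossingFamily Finset.univ B} : Finset _) :=
      Finset.mem_filter.2 ⟨Finset.mem_univ _, fun j => (hB j (Finset.mem_univ _)).1, hNC⟩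
    refine ⟨B, hmem, funext fun j => ?_⟩
    ext
    have := (Finset.isLeast_min' _ (hne B hmem j)).unique (hB j (Finset.mem_univ _)).2.1
    rw [this]
    simp

/-- In a partition with the prescribed numbers of parts, every part has a prescribed size. -/
theorem IsPartitionOf.exists_card_eq {m k : ℕ} (hm : 1 ≤ m) {α : Fin k → ℕ}
    (hα : ∑ i : Fin k, ((i : ℕ) + 1) * α i = k) {P : Finset (Finset (Fin (m * k)))}
    (hP : IsPartitionOf (m * k) P)
    (hc : ∀ i : Fin k, #{p ∈ P | #p = m * ((i : ℕ) + 1)} = α i) {p : Finset (Fin (m * k))}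
    (hp : p ∈ P) : ∃ i : Fin k, #p = m * ((i : ℕ) + 1) := by
  by_contra hno
  have htot : ∑ p ∈ P, #p = m * k := by
    have h1 := Finset.card_biUnion (s := P) (t := id) fun p hp q hq h => hP.2.1 p hp q hq h
    rw [← Finset.sup_eq_biUnion, hP.2.2, Finset.card_univ, Fintype.card_fin] at h1
    exact h1.symm
  have hsub : ∑ i : Fin k, ∑ p ∈ P with #p = m * ((i : ℕ) + 1), #p = m * k := by
    conv_rhs => rw [← hα, Finset.mul_sum]
    refine Finset.sum_congr rfl fun i _ => ?_
    rw [Finset.sum_congr rfl fun p hp => (Finset.mem_filter.1 hp).2, Finset.sum_const, hc,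
      smul_eq_mul]
    ring
  rw [← Finset.sum_biUnion] at hsub
  · have hlt : ∑ p ∈ Finset.univ.biUnion fun i : Fin k =>
        {p ∈ P | #p = m * ((i : ℕ) + 1)}, #p < ∑ p ∈ P, #p := by
      refine Finset.sum_lt_sum_of_subset (i := p) ?_ hp ?_
        (Finset.card_pos.2 (hP.1 p hp)) fun _ _ _ => Nat.zero_le _
      · exact Finset.biUnion_subset.2 fun _ _ => Finset.filter_subset _ _
      · simpa [hp] using hno
    omega
  · intro i _ j _ hij
    refine Finset.disjoint_left.2 fun p hp hp' => hij (Fin.ext ?_)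
    have := (Finset.mem_filter.1 hp).2.symm.trans (Finset.mem_filter.1 hp').2
    have := Nat.eq_of_mul_eq_mul_left hm this
    omega

theorem NonCrossingFamily.injective {ι β : Type*} [Fintype ι] [LinearOrder β]
    {B : ι → Finset β} (hB : NonCrossingFamily Finset.univ B) (hne : ∀ j, (B j).Nonempty) :
    Function.Injective B := by
  intro i j hij
  by_contra h
  have hd := (hB i (Finset.mem_univ _) j (Finset.mem_univ _) h).1
  rw [hij, disjoint_self] at hd
  exact (hne j).ne_empty hd

/-- The labelled non-crossing families with underlying partition `P` correspond to enumerations,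
for each size, of the parts of `P` of that size. -/
theorem card_labellings {m k : ℕ} (hm : 1 ≤ m) {α : Fin k → ℕ}
    (hα : ∑ i : Fin k, ((i : ℕ) + 1) * α i = k) {P : Finset (Finset (Fin (m * k)))}
    (hP : IsPartitionOf (m * k) P) (hNC : IsNonCrossing (m * k) P)
    (hc : ∀ i : Fin k, #{p ∈ P | #p = m * ((i : ℕ) + 1)} = α i) :
    #{B ∈ ({B : (Σ i, Fin (α i)) → Finset (Fin (m * k)) | (∀ j, #(B j) = m * ((j.1 : ℕ) + 1)) ∧
      NonCrossingFamily Finset.univ B} : Finset _) | Finset.univ.image B = P} =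
      ∏ i, (α i).factorial := by
  have hcard : Fintype.card (∀ i, Fin (α i) ≃ {p // p ∈ P.filter fun p => #p = m * ((i : ℕ) + 1)}) =
      ∏ i, (α i).factorial := by
    rw [Fintype.card_pi]
    refine Finset.prod_congr rfl fun i _ => ?_
    rw [Fintype.card_equiv (Fintype.equivOfCardEq (by
      rw [Fintype.card_coe, hc, Fintype.card_fin])), Fintype.card_fin]
  rw [← hcard, ← Finset.card_univ]
  symm
  refine Finset.card_bij (fun e _ j => (e j.1 j.2 : Finset (Fin (m * k)))) ?_ ?_ ?_
  · intro e _
    have hmem : ∀ j : Σ i, Fin (α i), (e j.1 j.2).1 ∈ P ∧ #(e j.1 j.2).1 = m * ((j.1 : ℕ) + 1) :=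
      fun j => Finset.mem_filter.1 (e j.1 j.2).2
    simp only [Finset.mem_filter, Finset.mem_univ, true_and]
    refine ⟨⟨fun j => (hmem j).2, ?_⟩, ?_⟩
    · rintro ⟨i, x⟩ - ⟨i', x'⟩ - hij
      have hne : (e i x).1 ≠ (e i' x').1 := by
        intro h
        have h1 := (hmem ⟨i, x⟩).2.symm.trans ((congrArg Finset.card h).trans (hmem ⟨i', x'⟩).2)
        have h2 := Nat.eq_of_mul_eq_mul_left hm h1
        obtain rfl : i = i' := Fin.ext (by simpa using h2)
        exact hij (by rw [(e i).injective (Subtype.ext h)])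
      refine ⟨hP.2.1 _ (hmem ⟨i, x⟩).1 _ (hmem ⟨i', x'⟩).1 hne, ?_⟩
      rintro a ha b hb c hc d hd ⟨h1, h2, h3⟩
      exact hNC ⟨a, b, c, d, h1, h2, h3, _, (hmem ⟨i, x⟩).1, _, (hmem ⟨i', x'⟩).1, hne,
        ha, hc, hb, hd⟩
    · ext p
      simp only [Finset.mem_image, Finset.mem_univ, true_and]
      constructor
      · rintro ⟨j, rfl⟩
        exact (hmem j).1
      · intro hp
        obtain ⟨i, hi⟩ := hP.exists_card_eq hm hα hc hp
        obtain ⟨x, hx⟩ := (e i).surjective ⟨p, Finset.mem_filter.2 ⟨hp, hi⟩⟩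
        exact ⟨⟨i, x⟩, by simp [hx]⟩
  · intro e _ e' _ h
    funext i
    ext1 x
    exact Subtype.ext (congrFun h ⟨i, x⟩)
  · intro B hB
    obtain ⟨⟨-, hBc, hBN⟩, rfl⟩ := by simpa only [Finset.mem_filter] using hB
    have hinj := hBN.injective fun j => Finset.card_pos.1 (by
      rw [hBc]; exact Nat.mul_pos hm (Nat.succ_pos _))
    refine ⟨fun i => Equiv.ofBijective (fun x => ⟨B ⟨i, x⟩, Finset.mem_filter.2
      ⟨Finset.mem_image_of_mem _ (Finset.mem_univ _), hBc _⟩⟩) ⟨fun x y h => ?_, ?_⟩,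
      Finset.mem_univ _, rfl⟩
    · simpa using hinj (Subtype.ext_iff.1 h)
    · rintro ⟨p, hp⟩
      obtain ⟨hp, hpc⟩ := Finset.mem_filter.1 hp
      obtain ⟨⟨i', x⟩, -, rfl⟩ := Finset.mem_image.1 hp
      rw [hBc] at hpc
      obtain rfl : i' = i := Fin.ext (by simpa using Nat.eq_of_mul_eq_mul_left hm hpc)
      exact ⟨x, rfl⟩

theorem NonCrossingFamily.isPartitionOf_image {ι : Type*} [Fintype ι] {n : ℕ}
    {B : ι → Finset (Fin n)} (hB : NonCrossingFamily Finset.univ B) (hne : ∀ j, (B j).Nonempty)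
    (hc : ∑ j, #(B j) = n) : IsPartitionOf n (Finset.univ.image B) := by
  refine ⟨by simpa using hne, ?_, ?_⟩
  · simp only [Finset.mem_image, Finset.mem_univ, true_and]
    rintro _ ⟨i, rfl⟩ _ ⟨j, rfl⟩ h
    exact (hB i (Finset.mem_univ _) j (Finset.mem_univ _) fun e => h (e ▸ rfl)).1
  · rw [Finset.sup_image, Function.id_comp, Finset.sup_eq_biUnion]
    exact hB.biUnion_eq (fun _ _ => Finset.subset_univ _) (by simpa using hc)

theorem NonCrossingFamily.isNonCrossing_image {ι : Type*} [Fintype ι] {n : ℕ}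
    {B : ι → Finset (Fin n)} (hB : NonCrossingFamily Finset.univ B) :
    IsNonCrossing n (Finset.univ.image B) := by
  rintro ⟨a, b, c, d, h1, h2, h3, p, hp, q, hq, hpq, ha, hc, hb, hd⟩
  obtain ⟨i, -, rfl⟩ := Finset.mem_image.1 hp
  obtain ⟨j, -, rfl⟩ := Finset.mem_image.1 hq
  exact (hB i (Finset.mem_univ _) j (Finset.mem_univ _) fun e => hpq (e ▸ rfl)).2
    a ha b hb c hc d hd ⟨h1, h2, h3⟩

/-- The number of non-crossing partitions of `[m·k]` with exactly `α i` parts of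
size `m·(i+1)` equals `C(mk, a-1) · (a-1)! / (α_1!⋯α_k!)`. -/
theorem stmt3 (m k : ℕ) (hm : 1 ≤ m) (hk : 0 < k) (α : Fin k → ℕ)
    (hα : ∑ i : Fin k, ((i : ℕ) + 1) * α i = k) (a : ℕ) (ha : a = ∑ i, α i) :
    (Finset.univ.filter (fun P : Finset (Finset (Fin (m * k))) =>
        IsPartitionOf (m * k) P ∧ IsNonCrossing (m * k) P ∧
        ∀ i : Fin k,
          (P.filter (fun p : Finset (Fin (m * k)) => p.card = m * ((i : ℕ) + 1))).card = α i)).card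
      * ∏ i, (α i).factorial
    = Nat.choose (m * k) (a - 1) * (a - 1).factorial := by
  have hsum : ∑ j : Σ i, Fin (α i), m * ((j.1 : ℕ) + 1) = m * k := by
    conv_rhs => rw [← hα, Finset.mul_sum]
    rw [Fintype.sum_sigma]
    refine Finset.sum_congr rfl fun i _ => ?_
    simp only [Finset.sum_const, Finset.card_univ, Fintype.card_fin, smul_eq_mul]
    ring
  have hpos : ∀ j : Σ i, Fin (α i), 0 < m * ((j.1 : ℕ) + 1) := fun j =>
    Nat.mul_pos hm (Nat.succ_pos _)
  have : Nonempty (Σ i, Fin (α i)) := by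
    by_contra h
    rw [not_nonempty_iff] at h
    rw [Finset.univ_eq_empty, Finset.sum_empty] at hsum
    exact (Nat.mul_pos hm hk).ne hsum
  have hcount := card_nonCrossingFamily (m * k) (fun j : Σ i, Fin (α i) => m * ((j.1 : ℕ) + 1))
    hpos hsum
  rw [Fintype.card_sigma] at hcount
  simp only [Fintype.card_fin, ← ha] at hcount
  rw [mul_comm (Nat.choose _ _), ← Nat.descFactorial_eq_factorial_mul_choose, ← hcount,
    Finset.card_eq_sum_card_fiberwise (f := fun B => Finset.univ.image B)
      (t := Finset.univ.filter fun P : Finset (Finset (Fin (m * k))) =>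
        IsPartitionOf (m * k) P ∧ IsNonCrossing (m * k) P ∧
        ∀ i : Fin k, #{p ∈ P | #p = m * ((i : ℕ) + 1)} = α i),
    Finset.sum_congr rfl fun P hP => ?_, Finset.sum_const, smul_eq_mul]
  · obtain ⟨-, hP, hNC, hc⟩ := Finset.mem_filter.1 hP
    convert card_labellings hm hα hP hNC hc
  · intro B hB
    obtain ⟨-, hBc, hBN⟩ := Finset.mem_filter.1 hB
    have hne : ∀ j, (B j).Nonempty := fun j => Finset.card_pos.1 (by rw [hBc]; exact hpos j)
    refine Finset.mem_filter.2 ⟨Finset.mem_univ _, hBN.isPartitionOf_image hne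
      ((Finset.sum_congr rfl fun j _ => hBc j).trans hsum), hBN.isNonCrossing_image, fun i => ?_⟩
    rw [Finset.filter_image, Finset.card_image_of_injective _ (hBN.injective hne)]
    simp only [hBc]
    rw [← Fintype.card_fin (α i), ← Finset.card_univ]
    symm
    refine Finset.card_bij (fun x _ => ⟨i, x⟩) (by simp) (by simp) ?_
    rintro ⟨i', x⟩ h
    obtain rfl : i' = i := Fin.ext (by
      simpa using Nat.eq_of_mul_eq_mul_left hm (Finset.mem_filter.1 h).2)
    exact ⟨x, Finset.mem_univ _, rfl⟩
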